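/- Let E be a finite-dimensional real inner product space, c > 0, x, x* ∈ E with x ≠ x*, and X := B̄(x*, (1 + c)‖x − x*‖). Let 0 < L ≤ μ, let f : E → ℝ be differentiable, convex on X, with gradient L-Lipschitz on X, let g : E → ℝ be convex on X and lower semicontinuous, assume F := f + g is μ-strongly convex on X, and assume x* is the minimizer of F on X. Let x⁺ be the minimizer over X of y ↦ ⟨∇f(x), y − x⟩ + (L/2)‖y − x‖² + g(y). Then ‖x⁺ − x*‖² ≤ (L/μ)·‖x − x*‖² ≤ ‖x − x*‖²; in particular x⁺ lies in the interior of X, so the composite gradient step does not increase the distance to the minimizer. -/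

import Mathlib

open scoped RealInnerProductSpace

section GradientBounds

variable {E : Type*} [NormedAddCommGroup E] [InnerProductSpace ℝ E]

/-- A strongly convex function grows at least quadratically away from a minimizer. -/
theorem StrongConvexOn.add_sq_norm_le_of_isMinOn {s : Set E} {m : ℝ} {φ : E → ℝ} {z y : E}
    (hφ : StrongConvexOn s m φ) (hz : z ∈ s) (hmin : IsMinOn φ s z) (hy : y ∈ s) :
    φ z + m / 2 * ‖y - z‖ ^ 2 ≤ φ y := by
  have hbound : ∀ t ∈ Set.Ioo (0 : ℝ) 1, φ z + (1 - t) * (m / 2 * ‖y - z‖ ^ 2) ≤ φ y := by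
    rintro t ⟨ht0, ht1⟩
    have hmem : t • y + (1 - t) • z ∈ s := hφ.1 hy hz ht0.le (by linarith) (by ring)
    have hle := hφ.2 hy hz ht0.le (by linarith : 0 ≤ 1 - t) (by ring)
    have hzle : φ z ≤ φ (t • y + (1 - t) • z) := hmin hmem
    simp only [smul_eq_mul] at hle
    refine le_of_mul_le_mul_left ?_ ht0
    linarith
  have hlim : Filter.Tendsto (fun t : ℝ => φ z + (1 - t) * (m / 2 * ‖y - z‖ ^ 2))
      (nhdsWithin 0 (Set.Ioi 0)) (nhds (φ z + m / 2 * ‖y - z‖ ^ 2)) := by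
    have hcont : Continuous fun t : ℝ => φ z + (1 - t) * (m / 2 * ‖y - z‖ ^ 2) := by fun_prop
    simpa using (hcont.tendsto 0).mono_left nhdsWithin_le_nhds
  refine le_of_tendsto hlim ?_
  filter_upwards [Ioo_mem_nhdsGT one_pos] with t ht using hbound t ht

/-- Adding a linear term and a quadratic proximal term to a convex function makes it strongly
convex. -/
theorem ConvexOn.strongConvexOn_inner_add_sq_add {s : Set E} {g : E → ℝ}
    (hg : ConvexOn ℝ s g) (v x : E) (L : ℝ) :
    StrongConvexOn s L fun y => ⟪v, y - x⟫ + L / 2 * ‖y - x‖ ^ 2 + g y := by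
  rw [strongConvexOn_iff_convex]
  refine ((((innerₛₗ ℝ (v - L • x)).convexOn hg.1).add hg).add_const
    (L / 2 * ‖x‖ ^ 2 - ⟪v, x⟫)).congr fun y _ => ?_
  simp [inner_sub_right, norm_sub_sq_real, real_inner_comm]
  ring

variable [CompleteSpace E]

theorem DifferentiableAt.hasDerivAt_comp_lineMap {f : E → ℝ} {x y : E} {t : ℝ}
    (hf : DifferentiableAt ℝ f (AffineMap.lineMap x y t)) :
    HasDerivAt (fun τ : ℝ => f (AffineMap.lineMap x y τ))
      ⟪gradient f (AffineMap.lineMap x y t), y - x⟫ t := by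
  simpa [Function.comp_def] using
    hf.hasGradientAt.hasFDerivAt.comp_hasDerivAt t AffineMap.hasDerivAt_lineMap

/-- The first-order lower bound for a convex function. -/
theorem ConvexOn.add_inner_gradient_le {s : Set E} {f : E → ℝ} {x y : E}
    (hconv : ConvexOn ℝ s f) (hf : DifferentiableAt ℝ f x) (hx : x ∈ s) (hy : y ∈ s) :
    f x + ⟪gradient f x, y - x⟫ ≤ f y := by
  have hderiv := DifferentiableAt.hasDerivAt_comp_lineMap (f := f) (x := x) (y := y) (t := 0)
    (by simpa using hf)
  have hslope := (hconv.comp_affineMap (AffineMap.lineMap x y : ℝ →ᵃ[ℝ] E)).le_slope_of_hasDerivAt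
    (x := 0) (y := 1) (by simpa using hx) (by simpa using hy) one_pos hderiv
  simp only [slope_def_field, Function.comp_apply, AffineMap.lineMap_apply_zero,
    AffineMap.lineMap_apply_one, sub_zero, div_one] at hslope
  linarith

/-- The descent lemma on a convex set. -/
theorem Convex.le_add_inner_gradient_add_sq {s : Set E} {f : E → ℝ} {L : ℝ} {x y : E}
    (hs : Convex ℝ s) (hf : Differentiable ℝ f) (hx : x ∈ s) (hy : y ∈ s)
    (hlip : ∀ z ∈ s, ‖gradient f z - gradient f x‖ ≤ L * ‖z - x‖) :
    f y ≤ f x + ⟪gradient f x, y - x⟫ + L / 2 * ‖y - x‖ ^ 2 := by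
  have hderiv : ∀ t : ℝ, HasDerivAt
      (fun τ : ℝ => f (AffineMap.lineMap x y τ) - τ * ⟪gradient f x, y - x⟫
        - L / 2 * ‖y - x‖ ^ 2 * τ ^ 2)
      (⟪gradient f (AffineMap.lineMap x y t), y - x⟫ - ⟪gradient f x, y - x⟫
        - L * ‖y - x‖ ^ 2 * t) t := fun t => by
    refine (((hf _).hasDerivAt_comp_lineMap.sub
      ((hasDerivAt_id t).mul_const ⟪gradient f x, y - x⟫)).sub
      ((hasDerivAt_pow 2 t).const_mul (L / 2 * ‖y - x‖ ^ 2))).congr_deriv ?_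
    push_cast
    ring
  have hanti := antitoneOn_of_deriv_nonpos (convex_Icc (0 : ℝ) 1)
    (fun t _ => (hderiv t).continuousAt.continuousWithinAt)
    (fun t _ => (hderiv t).differentiableAt.differentiableWithinAt) (by
      intro t ht
      rw [interior_Icc] at ht
      rw [(hderiv t).deriv, ← inner_sub_left]
      have hmem : AffineMap.lineMap x y t ∈ s := hs.lineMap_mem hx hy ⟨ht.1.le, ht.2.le⟩
      have hnorm : ‖AffineMap.lineMap x y t - x‖ = t * ‖y - x‖ := by
        simp [AffineMap.lineMap_apply, norm_smul, abs_of_pos ht.1]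
      have hinner := (real_inner_le_norm _ (y - x)).trans
        (mul_le_mul_of_nonneg_right (hlip _ hmem) (norm_nonneg (y - x)))
      rw [hnorm] at hinner
      linarith)
  have hle := hanti (Set.left_mem_Icc.2 zero_le_one) (Set.right_mem_Icc.2 zero_le_one) zero_le_one
  simp only [AffineMap.lineMap_apply_zero, AffineMap.lineMap_apply_one] at hle
  linarith

end GradientBounds

/-- **Nonexpansiveness of the composite gradient step when L ≤ μ, Euclidean instance.**
Corollary D.10 of "Implicit Riemannian Optimism with Applications to Min-Max Problems". -/
theorem crgd_nonexpansive
    {E : Type*} [NormedAddCommGroup E] [InnerProductSpace ℝ E] [FiniteDimensional ℝ E]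
    (c : ℝ) (hc : 0 < c) (x xstar : E) (hxne : x ≠ xstar)
    (L μ : ℝ) (hL : 0 < L) (hLμ : L ≤ μ)
    (f g : E → ℝ) (hf : Differentiable ℝ f)
    (hfconv : ConvexOn ℝ (Metric.closedBall xstar ((1 + c) * ‖x - xstar‖)) f)
    (hflip : ∀ p ∈ Metric.closedBall xstar ((1 + c) * ‖x - xstar‖),
      ∀ q ∈ Metric.closedBall xstar ((1 + c) * ‖x - xstar‖),
        ‖gradient f p - gradient f q‖ ≤ L * ‖p - q‖)
    (hgconv : ConvexOn ℝ (Metric.closedBall xstar ((1 + c) * ‖x - xstar‖)) g)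
    (hglsc : LowerSemicontinuous g)
    (hFsc : ConvexOn ℝ (Metric.closedBall xstar ((1 + c) * ‖x - xstar‖))
      (fun z => f z + g z - μ / 2 * ‖z‖ ^ 2))
    (hxstarmin : IsMinOn (fun z => f z + g z)
      (Metric.closedBall xstar ((1 + c) * ‖x - xstar‖)) xstar)
    (xp : E) (hxpmem : xp ∈ Metric.closedBall xstar ((1 + c) * ‖x - xstar‖))
    (hxpmin : IsMinOn (fun y => ⟪gradient f x, y - x⟫ + L / 2 * ‖y - x‖ ^ 2 + g y)
      (Metric.closedBall xstar ((1 + c) * ‖x - xstar‖)) xp) :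
    ‖xp - xstar‖ ^ 2 ≤ L / μ * ‖x - xstar‖ ^ 2
    ∧ L / μ * ‖x - xstar‖ ^ 2 ≤ ‖x - xstar‖ ^ 2
    ∧ xp ∈ interior (Metric.closedBall xstar ((1 + c) * ‖x - xstar‖)) := by
  set X := Metric.closedBall xstar ((1 + c) * ‖x - xstar‖) with hX
  have hd : 0 < ‖x - xstar‖ := norm_pos_iff.2 (sub_ne_zero.2 hxne)
  have hμ : 0 < μ := hL.trans_le hLμ
  have hxX : x ∈ X := by
    rw [hX, mem_closedBall_iff_norm]
    nlinarith
  have hsX : xstar ∈ X := Metric.mem_closedBall_self (by positivity)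
  have hgrowth := (strongConvexOn_iff_convex.2 hFsc).add_sq_norm_le_of_isMinOn hsX hxstarmin hxpmem
  have hstep := (hgconv.strongConvexOn_inner_add_sq_add (gradient f x) x L).add_sq_norm_le_of_isMinOn
    hxpmem hxpmin hsX
  have hlower := hfconv.add_inner_gradient_le (hf x) hxX hsX
  have hupper := hfconv.1.le_add_inner_gradient_add_sq hf hxX hxpmem fun z hz => hflip z hz x hxX
  rw [norm_sub_rev xstar xp, norm_sub_rev xstar x] at hstep
  have hsq : 0 ≤ L * ‖xp - xstar‖ ^ 2 := by positivity
  have hcontract : ‖xp - xstar‖ ^ 2 ≤ L / μ * ‖x - xstar‖ ^ 2 := by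
    rw [div_mul_eq_mul_div, le_div_iff₀ hμ]
    linarith
  have hratio : L / μ * ‖x - xstar‖ ^ 2 ≤ ‖x - xstar‖ ^ 2 :=
    mul_le_of_le_one_left (by positivity) ((div_le_one hμ).2 hLμ)
  refine ⟨hcontract, hratio, Metric.ball_subset_interior_closedBall ?_⟩
  have hle : ‖xp - xstar‖ ≤ ‖x - xstar‖ :=
    le_of_sq_le_sq (hcontract.trans hratio) hd.le
  rw [mem_ball_iff_norm]
  nlinarith
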